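/- An endomorphism f of the free monoid over A = {a,b} maps every Christoffel word to a Christoffel word if and only if f = λ_v for some word v ∈ A*. (In other words, the monoid of Christoffel morphisms is exactly the monoid generated by λ_a and λ_b.) -/

import Mathlib

namespace Chri

/-- Length of the longest palindromic suffix of `w`. -/
def lpsLen (w : List Bool) : ℕ :=
  ((List.range (w.length + 1)).filter
    (fun l => w.drop (w.length - l) == (w.drop (w.length - l)).reverse)).foldr max 0

/-- Right palindromic closure: the shortest palindrome having `w` as a prefix. -/
def palClosure (w : List Bool) : List Bool :=
  w ++ (w.take (w.length - lpsLen w)).reverse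

/-- The iterated palindromization map ψ. -/
def psi (v : List Bool) : List Bool :=
  v.foldl (fun w x => palClosure (w ++ [x])) []

/-- Apply a substitution (morphism of the free monoid) letter by letter. -/
def applyM (f : Bool → List Bool) (w : List Bool) : List Bool := (w.map f).flatten

/-- μ_x : x ↦ x, y ↦ xy (a = false, b = true). -/
def muL (x : Bool) : List Bool → List Bool :=
  applyM (fun y => if y = x then [x] else [x, y])

/-- λ_a = μ_a; λ_b : a ↦ ab, b ↦ b. -/
def lamL : Bool → List Bool → List Bool
  | false => applyM (fun y => if y = false then [false] else [false, true])
  | true  => applyM (fun y => if y = true then [true] else [false, true])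

/-- μ_{v₁⋯v_n} = μ_{v₁} ∘ ⋯ ∘ μ_{v_n}. -/
def muW : List Bool → List Bool → List Bool
  | [], w => w
  | x :: v, w => muL x (muW v w)

/-- λ_{v₁⋯v_n} = λ_{v₁} ∘ ⋯ ∘ λ_{v_n}. -/
def lamW : List Bool → List Bool → List Bool
  | [], w => w
  | x :: v, w => lamL x (lamW v w)

/-- Christoffel words: the letters and the words aψ(v)b. -/
def IsChristoffel (w : List Bool) : Prop :=
  w = [false] ∨ w = [true] ∨ ∃ v, w = false :: (psi v ++ [true])

/-- A word is constant if it is a power of a single letter. -/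
def IsConstant (v : List Bool) : Prop := ∃ x n, v = List.replicate n x

/-- ₊v : the longest proper suffix of v immediately preceded by the complement of
the first letter of v. -/
def plusV (v : List Bool) : List Bool :=
  (v.dropWhile (fun y => y == v.headD false)).tail

/-- v₊ : the longest proper prefix of v immediately followed by the complement of
the last letter of v. -/
def vPlus (v : List Bool) : List Bool := (plusV v.reverse).reverse

/-- α₀: the length of the first maximal block of `v` (the index). -/
def blockLen (v : List Bool) : ℕ :=
  (v.takeWhile (fun y => y == v.headD false)).length

/-- The list of lengths of the maximal blocks of equal letters of `v`
(the integral representation (α₀, …, α_n)). -/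
def blockLens : List Bool → List ℕ
  | [] => []
  | [_] => [1]
  | x :: y :: v =>
    if x = y then
      match blockLens (y :: v) with
      | [] => [1]
      | n :: ns => (n + 1) :: ns
    else 1 :: blockLens (y :: v)

/-- ext(v) = number of maximal blocks of v. -/
def ext (v : List Bool) : ℕ := (blockLens v).length

/-- π(w): the minimal period of `w` (with π(ε) = 1). -/
noncomputable def minPeriod (w : List Bool) : ℕ :=
  sInf {p | 0 < p ∧ ∀ i, i + p < w.length → w.getD i false = w.getD (i + p) false}

/-- φ_k : a ↦ a^{k+1} b, b ↦ a^k b. -/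
def phi (k : ℕ) : List Bool → List Bool :=
  applyM (fun y => if y = false then List.replicate (k + 1) false ++ [true]
                   else List.replicate k false ++ [true])

/-- φ̂_k : a ↦ a b^k, b ↦ a b^{k+1}. -/
def phiHat (k : ℕ) : List Bool → List Bool :=
  applyM (fun y => if y = false then false :: List.replicate k true
                   else false :: List.replicate (k + 1) true)

attribute [local instance] Classical.propDecidable

/-- The derivative ∂w of a proper Christoffel word w = aψ(v)b of index k:
∂(ab) = a, and otherwise the preimage of w under φ_k (if v starts with a)
or φ̂_k (if v starts with b). -/
noncomputable def derivC (w : List Bool) : List Bool :=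
  if w = [false, true] then [false]
  else if h : ∃ v, v ≠ [] ∧ w = false :: (psi v ++ [true]) then
    if h.choose.headD false = false then Function.invFun (phi (blockLen h.choose)) w
    else Function.invFun (phiHat (blockLen h.choose)) w
  else w

/-- The depth of a Christoffel word: the least d with ∂^d w a single letter. -/
noncomputable def depth (w : List Bool) : ℕ :=
  sInf {d | derivC^[d] w = [false] ∨ derivC^[d] w = [true]}

/-- The height h(v): the least n ≥ 1 such that v_(n) is constant, where
v_(1) = v and v_(n+1) = ₊(v_(n)). -/
noncomputable def height (v : List Bool) : ℕ :=
  sInf {n | 0 < n ∧ IsConstant (plusV^[n - 1] v)}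

/-- Helper computing δ_i from (α_{i-1}, δ_{i-1}) along the remaining exponents. -/
def ruleAux : ℕ → ℕ → List ℕ → List ℕ
  | _, _, [] => []
  | pa, pd, a :: rest =>
    let d := if 1 < a then 1 else if 1 < pa then 0 else 1 - pd
    d :: ruleAux a d rest

/-- The sequence δ₀, δ₁, …, δ_n computed by the recursive rule (δ₀ = 1). -/
def ruleSeq : List ℕ → List ℕ
  | [] => []
  | a :: rest => 1 :: ruleAux a 1 rest

/-- δ(v) = Σ_{i=0}^n δ_i(v), where additionally δ_n(v) = 1; δ(ε) = 1. -/
def delta (v : List Bool) : ℕ := ((ruleSeq (blockLens v)).dropLast).sum + 1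

/-- |u₁|: length of the longest prefix x₀⋯x_i of u with i < n and α₀ = ⋯ = α_i = 1
(and 0 if α₀ > 1 or n = 0). -/
def u1len (u : List Bool) : ℕ :=
  min ((blockLens u).takeWhile (fun n => n == 1)).length ((blockLens u).length - 1)

/-- |u₂|: the symmetric notion for suffixes. -/
def u2len (u : List Bool) : ℕ := u1len u.reverse

/-- The sequence H: H(1) = 0, H(2n) = H(n), H(4n±1) = H(n)+1. -/
def H : ℕ → ℕ
  | 0 => 0
  | 1 => 0
  | n + 2 =>
    if (n + 2) % 2 = 0 then H ((n + 2) / 2)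
    else if (n + 2) % 4 = 1 then H ((n + 2) / 4) + 1
    else H ((n + 3) / 4) + 1
decreasing_by all_goals omega

/-- ⟨w⟩: the word w read as an integer in base 2 (a = 0, b = 1). -/
def wordVal (w : List Bool) : ℕ :=
  w.foldl (fun acc x => 2 * acc + (if x then 1 else 0)) 0

/-- Membership in X^*: w is a concatenation of words of X. -/
def InStar (X : Set (List Bool)) (w : List Bool) : Prop :=
  ∃ l : List (List Bool), (∀ u ∈ l, u ∈ X) ∧ w = l.flatten

/-- w ∈ x⁺. -/
def PowPos (x : Bool) (w : List Bool) : Prop := ∃ k, 0 < k ∧ w = List.replicate k x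

theorem applyM_append (f : Bool → List Bool) (u w : List Bool) :
    applyM f (u ++ w) = applyM f u ++ applyM f w := by
  simp [applyM]

theorem muL_append (x : Bool) (u w : List Bool) : muL x (u ++ w) = muL x u ++ muL x w :=
  applyM_append _ u w

theorem muL_nil (x : Bool) : muL x [] = [] := rfl

theorem muL_cons_self (x : Bool) (w : List Bool) : muL x (x :: w) = x :: muL x w := by
  simp [muL, applyM]

theorem muL_cons_of_ne {x y : Bool} (h : y ≠ x) (w : List Bool) :
    muL x (y :: w) = x :: y :: muL x w := by
  simp [muL, applyM, h]

/-- Reversal conjugates `μ_x` by the letter `x`. -/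
theorem cons_reverse_muL (x : Bool) (w : List Bool) :
    x :: (muL x w).reverse = muL x w.reverse ++ [x] := by
  induction w with
  | nil => simp [muL_nil]
  | cons y w ih =>
    by_cases h : y = x
    · subst h
      simp [muL_cons_self, muL_append, muL_nil, ← ih]
    · simp [muL_cons_of_ne h, muL_append, muL_nil, ← List.cons_append, ih]

theorem reverse_muL_append (x : Bool) (w : List Bool) :
    (muL x w ++ [x]).reverse = muL x w.reverse ++ [x] := by
  simp [← cons_reverse_muL]

theorem muL_injective (x : Bool) : Function.Injective (muL x) := by
  intro u
  induction u with
  | nil =>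
    rintro (_ | ⟨y, w⟩) h
    · rfl
    · by_cases hy : y = x
      · subst hy; simp [muL_nil, muL_cons_self] at h
      · simp [muL_nil, muL_cons_of_ne hy] at h
  | cons z u ih =>
    have head_ne : ∀ (v : List Bool) {y : Bool}, y ≠ x → ∀ t, muL x v ≠ y :: t := by
      rintro (_ | ⟨c, v⟩) y hy t
      · simp [muL_nil]
      · by_cases hc : c = x
        · subst hc; simp [muL_cons_self, Ne.symm hy]
        · simp [muL_cons_of_ne hc, Ne.symm hy]
    rintro (_ | ⟨y, w⟩) h
    · by_cases hz : z = x
      · subst hz; simp [muL_nil, muL_cons_self] at h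
      · simp [muL_nil, muL_cons_of_ne hz] at h
    · by_cases hz : z = x <;> by_cases hy : y = x
      · subst hz; subst hy
        rw [muL_cons_self, muL_cons_self, List.cons.injEq] at h
        rw [ih h.2]
      · subst hz
        rw [muL_cons_self, muL_cons_of_ne hy, List.cons.injEq] at h
        exact absurd h.2 (head_ne u hy _)
      · subst hy
        rw [muL_cons_self, muL_cons_of_ne hz, List.cons.injEq] at h
        exact absurd h.2.symm (head_ne w hz _)
      · rw [muL_cons_of_ne hz, muL_cons_of_ne hy, List.cons.injEq, List.cons.injEq] at h
        rw [h.2.1, ih h.2.2]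

/-- A suffix of `μ_x(z)x` beginning with `x` is `μ_x(t)x` for a suffix `t` of `z`. -/
theorem exists_suffix_of_cons_suffix_muL (x : Bool) (z s : List Bool)
    (h : x :: s <:+ muL x z ++ [x]) : ∃ t, t <:+ z ∧ x :: s = muL x t ++ [x] := by
  induction z with
  | nil =>
    refine ⟨[], List.suffix_rfl, ?_⟩
    have := List.suffix_cons_iff.1 h
    simpa [muL_nil] using this
  | cons y z ih =>
    by_cases hy : y = x
    · subst hy
      rw [muL_cons_self, List.cons_append, List.suffix_cons_iff] at h
      rcases h with h | h
      · exact ⟨y :: z, List.suffix_rfl, by simpa [muL_cons_self] using h⟩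
      · obtain ⟨t, ht, e⟩ := ih h
        exact ⟨t, ht.trans (List.suffix_cons _ _), e⟩
    · rw [muL_cons_of_ne hy, List.cons_append, List.cons_append, List.suffix_cons_iff,
        List.suffix_cons_iff] at h
      rcases h with h | h | h
      · exact ⟨y :: z, List.suffix_rfl, by simpa [muL_cons_of_ne hy] using h⟩
      · exact absurd (List.cons.inj h).1.symm hy
      · obtain ⟨t, ht, e⟩ := ih h
        exact ⟨t, ht.trans (List.suffix_cons _ _), e⟩

/-- In `μ_x(z)` every letter other than `x` is preceded by `x`. -/
theorem cons_suffix_muL_of_ne {x c : Bool} (hc : c ≠ x) {t z : List Bool}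
    (h : c :: t <:+ muL x z) : x :: c :: t <:+ muL x z := by
  induction z with
  | nil => simp [muL_nil] at h
  | cons y z ih =>
    by_cases hy : y = x
    · subst hy
      rw [muL_cons_self, List.suffix_cons_iff] at h ⊢
      rcases h with h | h
      · exact absurd (List.cons.inj h).1 hc
      · exact Or.inr (ih h)
    · rw [muL_cons_of_ne hy] at h ⊢
      rcases List.suffix_cons_iff.1 h with h | h
      · exact absurd (List.cons.inj h).1 hc
      · rcases List.suffix_cons_iff.1 h with h | h
        · rw [h]
        · exact (ih h).trans ((List.suffix_cons _ _).trans (List.suffix_cons _ _))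

theorem length_muL_le_of_suffix (x : Bool) {t s : List Bool} (h : t <:+ s) :
    (muL x t).length ≤ (muL x s).length := by
  obtain ⟨u, rfl⟩ := h
  simp [muL_append]

/-- `s` is the longest palindromic suffix of `w`. -/
def IsLongestPalSuffix (s w : List Bool) : Prop :=
  s <:+ w ∧ s.reverse = s ∧ ∀ t, t <:+ w → t.reverse = t → t.length ≤ s.length

theorem foldr_max_mem_or_zero (l : List ℕ) : l.foldr max 0 ∈ l ∨ l.foldr max 0 = 0 := by
  induction l with
  | nil => simp
  | cons a l ih =>
    rw [List.foldr_cons]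
    rcases max_choice a (l.foldr max 0) with h | h <;> rw [h]
    · simp
    · rcases ih with h' | h'
      · exact Or.inl (List.mem_cons_of_mem _ h')
      · exact Or.inr h'

theorem le_foldr_max {l : List ℕ} {a : ℕ} (h : a ∈ l) : a ≤ l.foldr max 0 := by
  induction l with
  | nil => simp at h
  | cons b l ih =>
    rw [List.foldr_cons]
    rcases List.mem_cons.1 h with rfl | h
    · exact le_max_left _ _
    · exact (ih h).trans (le_max_right _ _)

theorem isLongestPalSuffix_drop (w : List Bool) :
    IsLongestPalSuffix (w.drop (w.length - lpsLen w)) w ∧ lpsLen w ≤ w.length := by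
  have hmem : lpsLen w ≤ w.length ∧
      (w.drop (w.length - lpsLen w)).reverse = w.drop (w.length - lpsLen w) := by
    rcases foldr_max_mem_or_zero ((List.range (w.length + 1)).filter
      (fun l => w.drop (w.length - l) == (w.drop (w.length - l)).reverse)) with h | h
    · change lpsLen w ∈ _ at h
      simp only [List.mem_filter, List.mem_range, beq_iff_eq] at h
      exact ⟨by omega, h.2.symm⟩
    · change lpsLen w = 0 at h
      simp [h]
  refine ⟨⟨List.drop_suffix _ _, hmem.2, fun t ht hp => ?_⟩, hmem.1⟩
  have hle := ht.length_le
  have : t.length ≤ lpsLen w := by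
    refine le_foldr_max ?_
    simp only [List.mem_filter, List.mem_range, beq_iff_eq]
    rw [← List.suffix_iff_eq_drop.1 ht]
    exact ⟨by omega, hp.symm⟩
  simp only [List.length_drop]
  omega

/-- The palindromic closure reflects what precedes the longest palindromic suffix. -/
theorem palClosure_eq {u s : List Bool} (h : IsLongestPalSuffix s (u ++ s)) :
    palClosure (u ++ s) = u ++ s ++ u.reverse := by
  obtain ⟨⟨h1, h2, h3⟩, h4⟩ := isLongestPalSuffix_drop (u ++ s)
  have e1 := h3 s h.1 h.2.1
  have e2 := h.2.2 _ h1 h2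
  have e : (u ++ s).length - lpsLen (u ++ s) = u.length := by
    simp only [List.length_drop, List.length_append] at *
    omega
  rw [palClosure, e, List.take_left]

theorem exists_palClosure_eq (w : List Bool) : ∃ u s, w = u ++ s ∧
    IsLongestPalSuffix s w ∧ palClosure w = u ++ s ++ u.reverse := by
  obtain ⟨h, -⟩ := isLongestPalSuffix_drop w
  obtain ⟨u, hu⟩ := h.1
  refine ⟨u, _, hu.symm, h, ?_⟩
  have := palClosure_eq (u := u) (s := w.drop (w.length - lpsLen w)) (by rwa [hu])
  rwa [hu] at this ⊢

theorem IsLongestPalSuffix.muL {s z : List Bool} (x : Bool) (h : IsLongestPalSuffix s z) :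
    IsLongestPalSuffix (muL x s ++ [x]) (muL x z ++ [x]) := by
  obtain ⟨u, rfl⟩ := h.1
  refine ⟨⟨Chri.muL x u, by simp [muL_append]⟩, by rw [reverse_muL_append, h.2.1], ?_⟩
  intro t ht hp
  rcases t with _ | ⟨c, t⟩
  · simp
  have hc : c = x := by
    obtain ⟨r, hr⟩ := ht
    have h1 := congrArg List.getLast? hr
    have h2 : (c :: t).getLast? = some c := by
      rw [← hp, List.getLast?_reverse]; rfl
    rw [List.getLast?_append, h2] at h1
    simpa using h1
  subst hc
  obtain ⟨t', ht', e⟩ := exists_suffix_of_cons_suffix_muL c _ _ ht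
  have hp' : t'.reverse = t' := by
    rw [e, reverse_muL_append] at hp
    exact muL_injective c (List.append_cancel_right hp)
  have hts : t' <:+ s := List.suffix_of_suffix_length_le ht' h.1 (h.2.2 _ ht' hp')
  rw [e]
  simpa using length_muL_le_of_suffix c hts

theorem palClosure_muL_append (x : Bool) (z : List Bool) :
    palClosure (muL x z ++ [x]) = muL x (palClosure z) ++ [x] := by
  obtain ⟨u, s, rfl, h, e⟩ := exists_palClosure_eq z
  have h' := h.muL x
  rw [muL_append, List.append_assoc] at h' ⊢
  rw [palClosure_eq h', e]
  simp [muL_append, ← cons_reverse_muL]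

theorem palClosure_muL_concat_of_ne {x y : Bool} (hy : y ≠ x) (w : List Bool) :
    palClosure (muL x (w ++ [y])) = muL x (palClosure (w ++ [y])) ++ [x] := by
  obtain ⟨u, s, hus, h, e⟩ := exists_palClosure_eq (w ++ [y])
  have h' := h.muL x
  obtain ⟨s, rfl⟩ : ∃ s', s = y :: s' := by
    have hlen := h.2.2 [y] (List.suffix_append _ _) rfl
    rcases s with _ | ⟨c, s⟩
    · simp at hlen
    have h1 := congrArg List.getLast? hus
    have h2 : (c :: s).getLast? = some c := by
      rw [← h.2.1, List.getLast?_reverse]; rfl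
    rw [List.getLast?_append, List.getLast?_append, h2] at h1
    simp at h1
    exact ⟨s, by rw [h1]⟩
  have hdecomp : muL x (w ++ [y]) = (muL x u ++ [x]) ++ (y :: muL x s) := by
    simp [hus, muL_append, muL_cons_of_ne hy]
  have hlong : IsLongestPalSuffix (y :: muL x s) ((muL x u ++ [x]) ++ (y :: muL x s)) := by
    refine ⟨List.suffix_append _ _, ?_, ?_⟩
    · have hp := h'.2.1
      rw [muL_cons_of_ne hy] at hp
      refine List.append_cancel_right (bs := [x]) ?_
      simpa using hp
    · intro t ht hp
      rcases t with _ | ⟨c, t⟩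
      · simp
      rw [← hdecomp, muL_append, muL_cons_of_ne hy, muL_nil] at ht
      have hc : c = y := by
        obtain ⟨r, hr⟩ := ht
        have h1 := congrArg List.getLast? hr
        have h2 : (c :: t).getLast? = some c := by
          rw [← hp, List.getLast?_reverse]; rfl
        rw [List.getLast?_append, h2] at h1
        simpa using h1
      subst hc
      have hext : x :: c :: t <:+ muL x (w ++ [c]) := by
        refine cons_suffix_muL_of_ne hy ?_
        rwa [muL_append, muL_cons_of_ne hy, muL_nil]
      have hle := h'.2.2 (x :: (c :: t) ++ [x]) (by
        obtain ⟨r, hr⟩ := hext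
        exact ⟨r, by rw [← hr]; simp⟩) (by
          simp only [List.reverse_append, List.reverse_cons] at hp ⊢
          simp [hp])
      rw [muL_cons_of_ne hy] at hle
      simpa using hle
  rw [hdecomp, palClosure_eq hlong, e]
  simp [muL_append, muL_cons_of_ne hy, ← cons_reverse_muL]

theorem psi_concat (v : List Bool) (y : Bool) : psi (v ++ [y]) = palClosure (psi v ++ [y]) := by
  simp [psi]

/-- Justin's formula. -/
theorem psi_cons (x : Bool) (v : List Bool) : psi (x :: v) = muL x (psi v) ++ [x] := by
  induction v using List.reverseRecOn with
  | nil => cases x <;> rfl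
  | append_singleton v y ih =>
    rw [← List.cons_append, psi_concat, psi_concat, ih]
    by_cases hy : y = x
    · subst hy
      rw [← palClosure_muL_append, muL_append, muL_cons_self, muL_nil]
    · rw [← palClosure_muL_concat_of_ne hy, muL_append, muL_cons_of_ne hy, muL_nil]
      simp

theorem lamL_append (x : Bool) (u w : List Bool) : lamL x (u ++ w) = lamL x u ++ lamL x w := by
  cases x <;> exact applyM_append _ u w

theorem lamL_false_eq_muL (w : List Bool) : lamL false w = muL false w := by
  simp only [lamL, muL]
  congr 1
  funext y
  cases y <;> rfl

/-- `λ_b` and `μ_b` are conjugate. -/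
theorem cons_lamL_true (w : List Bool) : true :: lamL true w = muL true w ++ [true] := by
  induction w with
  | nil => rfl
  | cons y w ih =>
    cases y
    · rw [muL_cons_of_ne (by simp), List.cons_append, List.cons_append, ← ih]; rfl
    · rw [muL_cons_self, List.cons_append, ← ih]; rfl

theorem lamL_injective (x : Bool) : Function.Injective (lamL x) := by
  cases x
  · simpa only [funext lamL_false_eq_muL] using muL_injective false
  · intro u w h
    have := congrArg (true :: ·) h
    simp only [cons_lamL_true] at this
    exact muL_injective true (List.append_cancel_right this)

theorem lamW_append (v u w : List Bool) : lamW v (u ++ w) = lamW v u ++ lamW v w := by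
  induction v with
  | nil => rfl
  | cons x v ih => simp only [lamW, ih, lamL_append]

theorem lamL_cons_psi (x : Bool) (v : List Bool) :
    lamL x (false :: (psi v ++ [true])) = false :: (psi (x :: v) ++ [true]) := by
  rw [psi_cons, ← List.singleton_append, lamL_append, lamL_append]
  cases x
  · rw [lamL_false_eq_muL (psi v)]
    simp [lamL, applyM]
  · rw [← cons_lamL_true]
    simp [lamL, applyM]

theorem cons_psi_concat_eq_lamW (v : List Bool) :
    false :: (psi v ++ [true]) = lamW v [false, true] := by
  induction v with
  | nil => rfl
  | cons x v ih => rw [← lamL_cons_psi, ih, lamW]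

theorem isChristoffel_iff (w : List Bool) :
    IsChristoffel w ↔ w = [false] ∨ w = [true] ∨ ∃ v, w = lamW v [false, true] := by
  simp only [IsChristoffel, cons_psi_concat_eq_lamW]

theorem IsChristoffel.lamL {w : List Bool} (x : Bool) (h : IsChristoffel w) :
    IsChristoffel (lamL x w) := by
  rw [isChristoffel_iff] at *
  rcases h with rfl | rfl | ⟨v, rfl⟩
  · cases x
    · exact Or.inl rfl
    · exact Or.inr (Or.inr ⟨[], rfl⟩)
  · cases x
    · exact Or.inr (Or.inr ⟨[], rfl⟩)
    · exact Or.inr (Or.inl rfl)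
  · exact Or.inr (Or.inr ⟨x :: v, rfl⟩)

theorem IsChristoffel.lamW {w : List Bool} (v : List Bool) (h : IsChristoffel w) :
    IsChristoffel (lamW v w) := by
  induction v with
  | nil => exact h
  | cons x v ih => exact ih.lamL x

theorem not_infix_lamL_false (w : List Bool) : ¬ [true, true] <:+: lamL false w := by
  induction w with
  | nil => simp [lamL, applyM]
  | cons y w ih =>
    rcases w with _ | ⟨z, w⟩
    · cases y <;> decide
    cases y <;> cases z <;>
      simpa [lamL, applyM, List.infix_cons_iff, List.cons_prefix_cons] using ih

theorem not_infix_lamL_true (w : List Bool) : ¬ [false, false] <:+: lamL true w := by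
  induction w with
  | nil => simp [lamL, applyM]
  | cons y w ih =>
    rcases w with _ | ⟨z, w⟩
    · cases y <;> decide
    cases y <;> cases z <;>
      simpa [lamL, applyM, List.infix_cons_iff, List.cons_prefix_cons] using ih

/-- A proper Christoffel word starts with `a` and ends with `b`. -/
theorem exists_lamW_eq (v : List Bool) : ∃ t, lamW v [false, true] = false :: (t ++ [true]) :=
  ⟨psi v, (cons_psi_concat_eq_lamW v).symm⟩

theorem infix_lamL_true_lamW (v : List Bool) :
    [true, true] <:+: lamL true (lamW v [false, true]) := by
  obtain ⟨t, ht⟩ := exists_lamW_eq v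
  rw [ht, ← List.singleton_append (l := t ++ [true]), lamL_append, lamL_append]
  have h : lamL true [false] ++ lamL true t = false :: (muL true t ++ [true]) := by
    rw [← cons_lamL_true]; rfl
  rw [← List.append_assoc, h]
  exact ⟨false :: muL true t, [], by simp [lamL, applyM]⟩

theorem infix_lamL_false_lamW (v : List Bool) :
    [false, false] <:+: lamL false (lamW v [false, true]) := by
  obtain ⟨t, ht⟩ := exists_lamW_eq v
  rw [ht, ← List.singleton_append (l := t ++ [true]), lamL_append]
  rcases t with _ | ⟨_ | _, t⟩ <;> exact ⟨[], _, rfl⟩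

/-- A proper Christoffel word avoiding the square of the letter other than `x` is
the image under `λ_x` of a Christoffel word. -/
theorem exists_lamL_eq {x : Bool} {v : List Bool}
    (h : ¬ [!x, !x] <:+: lamW v [false, true]) :
    ∃ p, IsChristoffel p ∧ lamL x p = lamW v [false, true] := by
  rcases v with _ | ⟨y, v⟩
  · exact ⟨[!x], by cases x <;> simp [IsChristoffel], by cases x <;> rfl⟩
  · have hy : y = x := by
      cases x <;> cases y
      · rfl
      · exact absurd (infix_lamL_true_lamW v) h
      · exact absurd (infix_lamL_false_lamW v) h
      · rfl
    subst hy
    exact ⟨_, (isChristoffel_iff _).2 (Or.inr (Or.inr ⟨v, rfl⟩)), rfl⟩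

theorem not_infix_lamL (x : Bool) (w : List Bool) : ¬ [!x, !x] <:+: lamL x w := by
  cases x
  · exact not_infix_lamL_false w
  · exact not_infix_lamL_true w

/-- The standard factorization of a Christoffel word is unique. -/
theorem exists_eq_lamW_of_append {p q : List Bool} (u : List Bool)
    (hp : IsChristoffel p) (hq : IsChristoffel q) (h : p ++ q = lamW u [false, true]) :
    ∃ v, p = lamW v [false] ∧ q = lamW v [true] := by
  induction u generalizing p q with
  | nil =>
    have hlen : p ≠ [] ∧ q ≠ [] := by
      constructor <;> rintro rfl <;> simp [IsChristoffel] at hp hq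
    rcases p with _ | ⟨c, _ | ⟨d, p⟩⟩ <;> rcases q with _ | ⟨e, q⟩ <;>
      simp [lamW] at h hlen
    exact ⟨[], by simp [lamW, h]⟩
  | cons x u ih =>
    have hsq := not_infix_lamL x (lamW u [false, true])
    change p ++ q = lamL x (lamW u [false, true]) at h
    rw [← h] at hsq
    obtain ⟨t, ht⟩ := exists_lamW_eq (x :: u)
    change lamL x (lamW u [false, true]) = _ at ht
    have hne : p ++ q ≠ [false, true] := by
      intro h'
      obtain ⟨s, hs⟩ := exists_lamW_eq u
      have h1 : lamL x [!x] = lamL x (lamW u [false, true]) := by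
        rw [← h, h']; cases x <;> rfl
      rw [hs] at h1
      simpa using lamL_injective x h1
    have hp' : p ≠ [true] := by
      rintro rfl; rw [ht] at h; simp at h
    have hq' : q ≠ [false] := by
      rintro rfl
      rw [ht, ← List.cons_append] at h
      simpa only [List.getLast?_concat, Option.some.injEq, Bool.false_eq_true] using
        congrArg List.getLast? h
    rw [isChristoffel_iff] at hp hq
    have key : ∃ p' q', IsChristoffel p' ∧ IsChristoffel q' ∧ lamL x p' = p ∧ lamL x q' = q := by
      rcases hp with rfl | rfl | ⟨v, rfl⟩
      · rcases hq with rfl | rfl | ⟨v', rfl⟩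
        · exact absurd rfl hq'
        · exact absurd rfl hne
        · cases x
          · obtain ⟨q', hq1, hq2⟩ := exists_lamL_eq (fun hi =>
              hsq (hi.trans (List.suffix_append _ _).isInfix))
            exact ⟨[false], q', Or.inl rfl, hq1, rfl, hq2⟩
          · obtain ⟨s, hs⟩ := exists_lamW_eq v'
            exact absurd ⟨[], s ++ [true], by simp [hs]⟩ hsq
      · exact absurd rfl hp'
      · obtain ⟨p', hp1, hp2⟩ := exists_lamL_eq (fun hi =>
          hsq (hi.trans (List.prefix_append _ _).isInfix))
        rcases hq with rfl | rfl | ⟨v', rfl⟩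
        · exact absurd rfl hq'
        · cases x
          · obtain ⟨s, hs⟩ := exists_lamW_eq v
            exact absurd ⟨false :: s, [], by simp [hs]⟩ hsq
          · exact ⟨p', [true], hp1, Or.inr (Or.inl rfl), hp2, rfl⟩
        · obtain ⟨q', hq1, hq2⟩ := exists_lamL_eq (fun hi =>
            hsq (hi.trans (List.suffix_append _ _).isInfix))
          exact ⟨p', q', hp1, hq1, hp2, hq2⟩
    obtain ⟨p', q', hp1, hq1, rfl, rfl⟩ := key
    rw [← lamL_append] at h
    obtain ⟨v, rfl, rfl⟩ := ih hp1 hq1 (lamL_injective x h)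
    exact ⟨x :: v, rfl, rfl⟩

/-- an endomorphism of the free monoid preserves Christoffel words
iff it is λ_v for some word v. -/
theorem christoffel_morphism_iff (f : List Bool → List Bool)
    (hf : ∀ u w : List Bool, f (u ++ w) = f u ++ f w) :
    (∀ w, IsChristoffel w → IsChristoffel (f w)) ↔ ∃ v, f = lamW v := by
  constructor
  · intro h
    have ha := h [false] (Or.inl rfl)
    have hb := h [true] (Or.inr (Or.inl rfl))
    have hab := h ([false] ++ [true]) (Or.inr (Or.inr ⟨[], rfl⟩))
    rw [hf, isChristoffel_iff] at hab
    have hlen : 2 ≤ (f [false] ++ f [true]).length := by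
      have pos : ∀ {w}, IsChristoffel w → 0 < w.length := by
        rintro w (rfl | rfl | ⟨v, rfl⟩) <;> simp
      have := pos ha
      have := pos hb
      rw [List.length_append]
      omega
    rcases hab with e | e | ⟨u, hu⟩
    · simp [e] at hlen
    · simp [e] at hlen
    · obtain ⟨v, hva, hvb⟩ := exists_eq_lamW_of_append u ha hb hu
      have nil_of : ∀ g : List Bool → List Bool,
          (∀ u w, g (u ++ w) = g u ++ g w) → g [] = [] := fun g hg => by
        simpa using hg [] []
      refine ⟨v, funext fun w => ?_⟩
      induction w with
      | nil => rw [nil_of f hf, nil_of _ (lamW_append v)]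
      | cons y w ih =>
        rw [← List.singleton_append, hf, lamW_append, ih]
        cases y
        · rw [hva]
        · rw [hvb]
  · rintro ⟨v, rfl⟩ w hw
    exact hw.lamW v


end Chri
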